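/- arXiv:math/0406387 — 3 statements merged into one kernel-verified Lean document; each statement's English description precedes it below -/
import Mathlib

section
/- Let s ≥ 1 be an integer and let k, d, c : ℤ/sℤ → ℤ be functions indexed cyclically, satisfying k_i ≥ 1, d_i ≥ 2 and c_i ≥ 0 for all i, together with the relation (k_{j-1} - 1) + (k_{j+1} - 1) + c_j = (k_j - 1)·d_j for every j ∈ ℤ/sℤ. If k_{j₀} = 1 for some index j₀, then k_i = 1 for all i and c_i = 0 for all i. -/
/-- Cyclic combinatorial lemma (Lemma 3.6 / relation (★)):
if `(k_{j-1} - 1) + (k_{j+1} - 1) + c_j = (k_j - 1)·d_j` for all `j ∈ ℤ/sℤ`,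
with `k_i ≥ 1`, `d_i ≥ 2`, `c_i ≥ 0`, and `k_{j₀} = 1` for some `j₀`, then
`k_i = 1` and `c_i = 0` for all `i`. -/
theorem stmt_2 (s : ℕ) (hs : 1 ≤ s) (k d c : ZMod s → ℤ)
    (hk : ∀ i, 1 ≤ k i) (hd : ∀ i, 2 ≤ d i) (hc : ∀ i, 0 ≤ c i)
    (hrel : ∀ j, (k (j - 1) - 1) + (k (j + 1) - 1) + c j = (k j - 1) * d j)
    (j₀ : ZMod s) (hj₀ : k j₀ = 1) :
    (∀ i, k i = 1) ∧ (∀ i, c i = 0) := by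
  have step : ∀ j, k j = 1 → k (j + 1) = 1 ∧ c j = 0 := by
    intro j hj
    have h := hrel j
    rw [hj, sub_self, zero_mul] at h
    have h₁ := hk (j - 1)
    have h₂ := hk (j + 1)
    have h₃ := hc j
    constructor <;> linarith
  have along : ∀ n : ℕ, k (j₀ + n) = 1 := by
    intro n
    induction n with
    | zero => simpa using hj₀
    | succ n ih =>
      rw [Nat.cast_succ, ← add_assoc]
      exact (step _ ih).1
  have : NeZero s := ⟨by omega⟩
  have all : ∀ i, k i = 1 := by
    intro i
    have h := along (i - j₀).val
    rwa [ZMod.natCast_zmod_val, add_sub_cancel] at h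
  exact ⟨all, fun i => (step i (all i)).2⟩
end

section
/- Let s ≥ 1 be an integer and let k, d, c : ℤ/sℤ → ℤ satisfy k_i ≥ 2, d_i ≥ 2 and c_i ≥ 0 for all i, together with the relation (k_{j-1} - 1) + (k_{j+1} - 1) + c_j = (k_j - 1)·d_j for every j ∈ ℤ/sℤ. If there exists an index j₀ with d_{j₀} ≥ 3, then there exists an index j such that k_j = max_i k_i and c_j > 0. -/
/-- Cyclic combinatorial lemma (case ii) of Proposition 3.8):
if `(k_{j-1} - 1) + (k_{j+1} - 1) + c_j = (k_j - 1)·d_j` for all `j ∈ ℤ/sℤ`,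
with `k_i ≥ 2`, `d_i ≥ 2`, `c_i ≥ 0`, and `d_{j₀} ≥ 3` for some `j₀`, then the
maximum of `k` is attained at some index `j` with `c_j > 0`. -/
theorem stmt_3 (s : ℕ) (hs : 1 ≤ s) (k d c : ZMod s → ℤ)
    (hk : ∀ i, 2 ≤ k i) (hd : ∀ i, 2 ≤ d i) (hc : ∀ i, 0 ≤ c i)
    (hrel : ∀ j, (k (j - 1) - 1) + (k (j + 1) - 1) + c j = (k j - 1) * d j)
    (j₀ : ZMod s) (hj₀ : 3 ≤ d j₀) :
    ∃ j, (∀ i, k i ≤ k j) ∧ 0 < c j := by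
  have : NeZero s := ⟨by lia⟩
  obtain ⟨m, hm⟩ := Finite.exists_max k
  by_contra! hcon
  have step (j : ZMod s) (hj : ∀ i, k i ≤ k j) : k (j + 1) = k j ∧ d j = 2 := by
    have hr := hrel j
    have hcj := hcon j hj
    have hl := hj (j - 1)
    have hu := hj (j + 1)
    have hkj := hk j
    have hdj := hd j
    constructor <;> nlinarith
  have all_max (n : ℕ) : k (m + n) = k m := by
    induction n with
    | zero => simp
    | succ n ih =>
      rw [Nat.cast_succ, ← add_assoc, (step _ fun i => ih ▸ hm i).1, ih]
  have hj₀max : k j₀ = k m := by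
    simpa using all_max (j₀ - m).val
  have := (step j₀ fun i => hj₀max ▸ hm i).2
  lia
end

section
/- Let n ≥ 1, let i₀, i₁ ∈ Fin n with i₀ ≠ i₁, and let I₀, I₁ ⊆ Fin n be finite subsets with i₀ ∉ I₀ and i₁ ∉ I₁. In the module of functions Fin n → ℤ with the bilinear form B(u,v) = -∑_i u_i·v_i, set D₀ = e_{i₀} - ∑_{k ∈ I₀} e_k and D₁ = e_{i₁} - ∑_{k ∈ I₁} e_k, where e_i denotes the i-th standard basis vector. If B(D₀, D₁) = 2, then i₀ ∈ I₁, i₁ ∈ I₀, and I₀ ∩ I₁ = ∅. -/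
/-- The standard pairing of `e_a - ∑_{k ∈ s} e_k` with `e_b - ∑_{k ∈ t} e_k`. -/
theorem sum_single_sub_mul_single_sub {ι : Type*} [Fintype ι] [DecidableEq ι]
    (a b : ι) (s t : Finset ι) :
    ∑ i, (Pi.single a 1 - ∑ k ∈ s, Pi.single k 1 : ι → ℤ) i *
        (Pi.single b 1 - ∑ k ∈ t, Pi.single k 1 : ι → ℤ) i =
      (if a = b then 1 else 0) - (if a ∈ t then 1 else 0) - (if b ∈ s then 1 else 0) +
        ((s ∩ t).card : ℤ) := by
  have indicator (u : Finset ι) (i : ι) :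
      (∑ k ∈ u, Pi.single k 1 : ι → ℤ) i = if i ∈ u then 1 else 0 := by
    simp [Finset.sum_apply, Pi.single_apply]
  have inter : ∑ i, (if i ∈ s then 1 else 0) * (if i ∈ t then 1 else 0) =
      ((s ∩ t).card : ℤ) := by
    simp [← ite_and, ← Finset.mem_inter, Finset.inter_comm]
  simp only [Pi.sub_apply, indicator, sub_mul, mul_sub, Finset.sum_sub_distrib, inter]
  simp [Pi.single_apply, eq_comm (a := b)]
  ring

/-- Lattice computation (step 2 of Proposition 3.15): with
`B(u,v) = -∑ i, u i * v i`, `D₀ = e_{i₀} - ∑_{k ∈ I₀} e_k` and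
`D₁ = e_{i₁} - ∑_{k ∈ I₁} e_k` (where `i₀ ∉ I₀`, `i₁ ∉ I₁`, `i₀ ≠ i₁`),
the condition `B(D₀, D₁) = 2` forces `i₀ ∈ I₁`, `i₁ ∈ I₀` and `I₀ ∩ I₁ = ∅`. -/
theorem stmt_9 (n : ℕ) (hn : 1 ≤ n) (i₀ i₁ : Fin n) (hne : i₀ ≠ i₁)
    (I₀ I₁ : Finset (Fin n)) (h₀ : i₀ ∉ I₀) (h₁ : i₁ ∉ I₁)
    (D₀ D₁ : Fin n → ℤ)
    (hD₀ : D₀ = Pi.single i₀ 1 - ∑ k ∈ I₀, Pi.single k 1)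
    (hD₁ : D₁ = Pi.single i₁ 1 - ∑ k ∈ I₁, Pi.single k 1)
    (hB : -(∑ i, D₀ i * D₁ i) = 2) :
    i₀ ∈ I₁ ∧ i₁ ∈ I₀ ∧ I₀ ∩ I₁ = ∅ := by
  subst hD₀ hD₁
  rw [sum_single_sub_mul_single_sub, if_neg hne] at hB
  rw [← Finset.card_eq_zero]
  split_ifs at hB with ha hb hb
  · exact ⟨ha, hb, by omega⟩
  all_goals omega
end
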